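/- For each N ≥ 1, let X_N = U_N D_N U_N^* be an N×N Hermitian random matrix, where U_N is Haar-distributed on the unitary group U(N) and D_N is a random real diagonal matrix independent of U_N. Let λ_1^{(N)} ≤ ⋯ ≤ λ_N^{(N)} be the eigenvalues of X_N, let m_N = (1/N) Σ_{i=1}^N δ_{λ_i^{(N)}} be the empirical eigenvalue distribution, and let λ̃_1^{(N)} ≤ ⋯ ≤ λ̃_{N−1}^{(N)} be the eigenvalues of the principal submatrix X̃_N obtained by deleting the last row and column of X_N. Set M_k(κ_N) = Σ_{i=1}^N (λ_i^{(N)})^k − Σ_{j=1}^{N−1} (λ̃_j^{(N)})^k, and suppose that for each N there is a random probability measure g_N on ℝ (the transition measure of κ_N) with finite moments of all orders satisfying the formal power series identity Σ_{n≥0} M_n(g_N) z^n = exp(Σ_{k≥1} (M_k(κ_N)/k) z^k). Let m be a probability measure on ℝ with finite moments of all orders whose moment sequence {M_k(m)}_{k≥1} is determinate (m is the unique probability measure with these moments). Assume: (i) sup_{N≥1} E[M_k(m_N)] < ∞ for every even k; and (ii) for every k ≥ 1 and every ε > 0, P(|M_k(m_N) − M_k(m)| ≥ ε) → 0 as N →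 ∞. Then g_N converges weakly to m in probability: for every bounded continuous function f : ℝ → ℝ and every ε > 0, P(|∫ f dg_N − ∫ f dm| ≥ ε) → 0 as N → ∞. -/

import Mathlib

open MeasureTheory ProbabilityTheory Finset
open scoped Classical

/-- Measurable structure on matrices (entrywise, i.e. the product σ-algebra). -/
instance matrixMeasurableSpace {m n α : Type*} [MeasurableSpace α] :
    MeasurableSpace (Matrix m n α) :=
  inferInstanceAs (MeasurableSpace (m → n → α))

open PowerSeries in
/-- The logarithmic derivative of `∏ (1 - x z)`. -/
theorem derivative_prod_one_sub_C_mul_X {ι R : Type*} [CommRing R] (s : Finset ι) (x : ι → R) :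
    d⁄dX R (∏ i ∈ s, (1 - C (x i) * X)) =
      -((∏ i ∈ s, (1 - C (x i) * X)) * PowerSeries.mk fun k => ∑ i ∈ s, x i ^ (k + 1)) := by
  induction s using Finset.induction_on with
  | empty =>
    have : (PowerSeries.mk fun _ => (0 : R)) = 0 := by ext; simp
    simp [this]
  | insert i s hi ih =>
    have h1 : d⁄dX R (1 - C (x i) * X) = - C (x i) := by
      simp
    have h2 : (1 - C (x i) * X) * PowerSeries.mk (fun k => x i ^ (k + 1)) = C (x i) := by
      ext k
      rw [sub_mul, one_mul, mul_assoc, map_sub, coeff_C_mul]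
      cases k with
      | zero => simp
      | succ k => simp [coeff_succ_X_mul, pow_succ']
    have h3 : (PowerSeries.mk fun k => ∑ j ∈ insert i s, x j ^ (k + 1)) =
        PowerSeries.mk (fun k => x i ^ (k + 1)) +
          PowerSeries.mk fun k => ∑ j ∈ s, x j ^ (k + 1) := by
      ext k
      simp [Finset.sum_insert hi]
    rw [Finset.prod_insert hi, Derivation.leibniz, ih, h1, h3, smul_eq_mul, smul_eq_mul]
    linear_combination (∏ i ∈ s, (1 - C (x i) * X)) * h2

open PowerSeries in
theorem det_one_sub_X_smul_of_diagonalization {ι R : Type*} [Fintype ι] [DecidableEq ι] [CommRing R]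
    (A V W : Matrix ι ι R) (x : ι → R) (hVW : V * W = 1)
    (hA : A = V * Matrix.diagonal x * W) :
    (1 - (X : R⟦X⟧) • A.map C).det = ∏ i, (1 - C (x i) * X) := by
  have hV : V.map (C (R := R)) * W.map C = 1 := by
    rw [← Matrix.map_mul, hVW, Matrix.map_one _ (map_zero _) (map_one _)]
  have h : 1 - (X : R⟦X⟧) • A.map C =
      V.map C * (Matrix.diagonal fun i => 1 - C (x i) * X) * W.map C := by
    have h1 : (Matrix.diagonal fun i => (1 - C (x i) * X : R⟦X⟧)) =
        1 - (X : R⟦X⟧) • (Matrix.diagonal x).map C := by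
      ext1 i j
      by_cases hij : i = j
      · subst hij; simp [mul_comm]
      · simp [hij]
    rw [h1, mul_sub, sub_mul, mul_one, hV, hA, Matrix.map_mul, Matrix.map_mul]
    simp
  rw [h, Matrix.det_mul, Matrix.det_mul, mul_right_comm, ← Matrix.det_mul, hV]
  simp

open PowerSeries in
theorem one_sub_X_smul_mul_resolvent {ι R : Type*} [Fintype ι] [DecidableEq ι] [CommRing R]
    (A : Matrix ι ι R) :
    (1 - (X : R⟦X⟧) • A.map C) * (Matrix.of fun i j => PowerSeries.mk fun k => (A ^ k) i j) = 1 := by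
  ext i j k
  rw [sub_mul, one_mul, Matrix.smul_mul, Matrix.sub_apply, Matrix.smul_apply, smul_eq_mul, map_sub,
    Matrix.of_apply, coeff_mk]
  cases k with
  | zero => by_cases hij : i = j <;> simp [Matrix.one_apply, hij]
  | succ k =>
    rw [coeff_succ_X_mul, Matrix.mul_apply, map_sum, pow_succ', Matrix.mul_apply]
    simp [Matrix.one_apply, apply_ite, coeff_one]

open PowerSeries in
/-- The moments of the spectral measure at the last basis vector satisfy the Markov–Krein
recursion with the differences of power sums of eigenvalues of `A` and of its principal
submatrix. -/
theorem markovKrein_recursion {R : Type*} [CommRing R] [IsDomain R] {n : ℕ}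
    (A V W : Matrix (Fin (n + 1)) (Fin (n + 1)) R)
    (x : Fin (n + 1) → R) (hVW : V * W = 1) (hA : A = V * Matrix.diagonal x * W)
    (V' W' : Matrix (Fin n) (Fin n) R) (y : Fin n → R) (hVW' : V' * W' = 1)
    (hA' : A.submatrix Fin.castSucc Fin.castSucc = V' * Matrix.diagonal y * W') (j : ℕ) :
    ((j + 1 : ℕ) : R) * (A ^ (j + 1)) (Fin.last n) (Fin.last n) =
      ∑ r ∈ Finset.range (j + 1), ((∑ i, x i ^ (r + 1)) - ∑ i, y i ^ (r + 1)) *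
        (A ^ (j - r)) (Fin.last n) (Fin.last n) := by
  set P : R⟦X⟧ := ∏ i, (1 - C (x i) * X) with hP
  set Q : R⟦X⟧ := ∏ i, (1 - C (y i) * X) with hQ
  set S : R⟦X⟧ := PowerSeries.mk fun k => (A ^ k) (Fin.last n) (Fin.last n) with hS
  set B : Matrix (Fin (n + 1)) (Fin (n + 1)) R⟦X⟧ := 1 - (X : R⟦X⟧) • A.map C with hB
  have hdet : B.det = P := det_one_sub_X_smul_of_diagonalization A V W x hVW hA
  have hadj : B.adjugate (Fin.last n) (Fin.last n) = Q := by
    rw [Matrix.adjugate_fin_succ_eq_det_submatrix, hQ,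
      ← det_one_sub_X_smul_of_diagonalization _ V' W' y hVW' hA']
    have : B.submatrix (Fin.last n).succAbove (Fin.last n).succAbove =
        1 - (X : R⟦X⟧) • (A.submatrix Fin.castSucc Fin.castSucc).map C := by
      ext1 a b
      simp [hB, Matrix.one_apply]
    rw [this]
    simp [← two_mul]
  have hQPS : Q = P * S := by
    have h := congrArg (fun M => B.adjugate * M) (one_sub_X_smul_mul_resolvent A)
    simp only [← mul_assoc, mul_one, ← hB] at h
    rw [Matrix.adjugate_mul, hdet, Matrix.smul_mul, one_mul] at h
    rw [← hadj, ← h]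
    simp [hS]
  have hP0 : P ≠ 0 := by
    intro h
    have := congrArg (constantCoeff (R := R)) h
    simp [hP, map_prod] at this
  have hder := congrArg (d⁄dX R) hQPS
  rw [Derivation.leibniz, hQ, hP, derivative_prod_one_sub_C_mul_X,
    derivative_prod_one_sub_C_mul_X, ← hP, ← hQ, hQPS, smul_eq_mul, smul_eq_mul] at hder
  have hmain : d⁄dX R S = ((PowerSeries.mk fun k => ∑ i, x i ^ (k + 1)) -
      PowerSeries.mk fun k => ∑ i, y i ^ (k + 1)) * S := by
    apply mul_left_cancel₀ hP0
    linear_combination -hder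
  have hc := congrArg (coeff j) hmain
  rw [coeff_derivative, coeff_mul, Finset.Nat.sum_antidiagonal_eq_sum_range_succ_mk] at hc
  simp only [hS, coeff_mk, map_sub] at hc
  rw [← hc]
  push_cast
  ring

open Filter Topology in
/-- Weak convergence and convergence of all moments give moments of all orders for the limit. -/
theorem integrable_pow_of_tendsto {μ : ℕ → ProbabilityMeasure ℝ} {ν : ProbabilityMeasure ℝ}
    (hμ : Tendsto μ atTop (𝓝 ν))
    (hint : ∀ n, ∀ j : ℕ, Integrable (fun x : ℝ => x ^ j) (μ n : Measure ℝ)) {c : ℕ → ℝ}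
    (hc : ∀ j : ℕ, 1 ≤ j → Tendsto (fun n => ∫ x, x ^ j ∂(μ n : Measure ℝ)) atTop (𝓝 (c j)))
    (j : ℕ) : Integrable (fun x : ℝ => x ^ j) (ν : Measure ℝ) := by
  have heven : ∀ k : ℕ, 1 ≤ k → Integrable (fun x : ℝ => x ^ (2 * k)) (ν : Measure ℝ) := by
    intro k hk
    have hle := lintegral_le_liminf_lintegral_of_forall_isOpen_measure_le_liminf_measure
      (μ := (ν : Measure ℝ)) (μs := fun n => (μ n : Measure ℝ)) (f := fun x => x ^ (2 * k))
      (by fun_prop) (fun x => (even_two_mul k).pow_nonneg x)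
      (fun G hG => ProbabilityMeasure.le_liminf_measure_open_of_tendsto hμ hG)
    have hlim : Tendsto (fun n => ∫⁻ x, ENNReal.ofReal (x ^ (2 * k)) ∂(μ n : Measure ℝ)) atTop
        (𝓝 (ENNReal.ofReal (c (2 * k)))) := by
      have := (ENNReal.continuous_ofReal.tendsto _).comp (hc (2 * k) (by omega))
      refine this.congr fun n => ?_
      exact ofReal_integral_eq_lintegral_ofReal (hint n _)
        (Eventually.of_forall fun x => (even_two_mul k).pow_nonneg x)
    rw [hlim.liminf_eq] at hle
    refine ⟨by fun_prop, ?_⟩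
    rw [hasFiniteIntegral_iff_ofReal
      (Eventually.of_forall fun x => (even_two_mul k).pow_nonneg x)]
    exact hle.trans_lt ENNReal.ofReal_lt_top
  rcases Nat.eq_zero_or_pos j with rfl | hj
  · simp
  refine ((integrable_const (1 : ℝ)).add (heven j hj)).mono' (by fun_prop)
    (Eventually.of_forall fun x => ?_)
  have : (x ^ j) ^ 2 = x ^ (2 * j) := by ring
  simp only [Real.norm_eq_abs, Pi.add_apply]
  nlinarith [sq_abs (x ^ j), sq_nonneg (|x ^ j| - 1), abs_nonneg (x ^ j)]

theorem abs_pow_sub_clamp_pow_le (j : ℕ) {R : ℝ} (hR : 1 ≤ R) (x : ℝ) (hj : 1 ≤ j) :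
    |x ^ j - (max (-R) (min x R)) ^ j| ≤ x ^ (2 * j) / R := by
  have hR0 : 0 < R := by linarith
  have hsq : x ^ (2 * j) = |x| ^ j * |x| ^ j := by
    rw [← pow_add, ← two_mul, (even_two_mul j).pow_abs]
  rw [le_div_iff₀ hR0, hsq]
  rcases le_total |x| R with h | h
  · obtain ⟨h1, h2⟩ := abs_le.1 h
    rw [min_eq_left h2, max_eq_right h1, sub_self, abs_zero, zero_mul]
    positivity
  · have hRj : R ≤ |x| ^ j := h.trans (le_self_pow₀ (hR.trans h) (by omega))
    refine mul_le_mul ?_ hRj hR0.le (by positivity)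
    rcases abs_cases x with ⟨hx, hx0⟩ | ⟨hx, hx0⟩
    · rw [hx] at h ⊢
      rw [min_eq_right h, max_eq_right (by linarith), abs_of_nonneg
        (sub_nonneg.2 (pow_le_pow_left₀ hR0.le h _))]
      linarith [pow_pos hR0 j]
    · have hxR : x = -|x| := by linarith
      rw [min_eq_left (by linarith), max_eq_left (by linarith), hxR, abs_neg, abs_abs, neg_pow,
        neg_pow R, ← mul_sub, abs_mul, abs_pow, abs_neg, abs_one, one_pow, one_mul, abs_of_nonneg
        (sub_nonneg.2 (pow_le_pow_left₀ hR0.le h _))]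
      linarith [pow_pos hR0 j]

theorem abs_integral_pow_sub_integral_clamp_pow_le (j : ℕ) {R : ℝ} (hR : 1 ≤ R) (hj : 1 ≤ j)
    (μ : Measure ℝ) [IsProbabilityMeasure μ] (h1 : Integrable (fun x : ℝ => x ^ j) μ)
    (h2 : Integrable (fun x : ℝ => x ^ (2 * j)) μ) :
    |∫ x, x ^ j ∂μ - ∫ x, (max (-R) (min x R)) ^ j ∂μ| ≤ (∫ x, x ^ (2 * j) ∂μ) / R := by
  have hclamp : Integrable (fun x : ℝ => (max (-R) (min x R)) ^ j) μ := by
    refine Integrable.of_bound (C := R ^ j) (by fun_prop) (Filter.Eventually.of_forall fun x => ?_)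
    rw [norm_pow, Real.norm_eq_abs]
    refine pow_le_pow_left₀ (abs_nonneg _) (abs_le.2 ⟨le_max_left _ _, ?_⟩) _
    exact max_le (by linarith) (min_le_right _ _)
  rw [← integral_sub h1 hclamp, ← integral_div]
  refine abs_integral_le_integral_abs.trans (integral_mono (h1.sub hclamp).abs (h2.div_const R) ?_)
  exact fun x => abs_pow_sub_clamp_pow_le j hR x hj

open Filter Topology in
/-- Weak convergence and convergence of all moments identify the moments of the limit. -/
theorem integral_pow_eq_of_tendsto {μ : ℕ → ProbabilityMeasure ℝ} {ν : ProbabilityMeasure ℝ}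
    (hμ : Tendsto μ atTop (𝓝 ν))
    (hint : ∀ n, ∀ j : ℕ, Integrable (fun x : ℝ => x ^ j) (μ n : Measure ℝ)) {c : ℕ → ℝ}
    (hc : ∀ j : ℕ, 1 ≤ j → Tendsto (fun n => ∫ x, x ^ j ∂(μ n : Measure ℝ)) atTop (𝓝 (c j)))
    {j : ℕ} (hj : 1 ≤ j) : ∫ x, x ^ j ∂(ν : Measure ℝ) = c j := by
  have hν := integrable_pow_of_tendsto hμ hint hc
  set A := ∫ x, x ^ (2 * j) ∂(ν : Measure ℝ)
  have hbound : ∀ R : ℝ, 1 ≤ R → |∫ x, x ^ j ∂(ν : Measure ℝ) - c j| ≤ (A + c (2 * j)) / R := by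
    intro R hR
    let φ : BoundedContinuousFunction ℝ ℝ := BoundedContinuousFunction.ofNormedAddCommGroup
      (fun x : ℝ => (max (-R) (min x R)) ^ j) (by fun_prop) (R ^ j) (fun x => by
        rw [norm_pow, Real.norm_eq_abs]
        refine pow_le_pow_left₀ (abs_nonneg _) (abs_le.2 ⟨le_max_left _ _, ?_⟩) _
        exact max_le (by linarith) (min_le_right _ _))
    have hφ := (ProbabilityMeasure.tendsto_iff_forall_integral_tendsto.1 hμ) φ
    have h1 := abs_integral_pow_sub_integral_clamp_pow_le j hR hj (ν : Measure ℝ) (hν _) (hν _)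
    have h2 : |c j - ∫ x, φ x ∂(ν : Measure ℝ)| ≤ c (2 * j) / R :=
      le_of_tendsto_of_tendsto' (((hc j hj).sub hφ).abs) ((hc (2 * j) (by omega)).div_const R)
        fun n => abs_integral_pow_sub_integral_clamp_pow_le j hR hj (μ n : Measure ℝ)
          (hint n _) (hint n _)
    change |_ - ∫ x, φ x ∂(ν : Measure ℝ)| ≤ _ at h1
    rw [add_div]
    refine (abs_sub_le _ (∫ x, φ x ∂(ν : Measure ℝ)) _).trans ?_
    rw [abs_sub_comm (∫ x, φ x ∂(ν : Measure ℝ))]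
    exact add_le_add h1 h2
  have hlim : Tendsto (fun R : ℝ => (A + c (2 * j)) / R) atTop (𝓝 0) :=
    tendsto_const_nhds.div_atTop tendsto_id
  have h0 := ge_of_tendsto hlim ((eventually_ge_atTop 1).mono hbound)
  exact sub_eq_zero.1 (abs_eq_zero.1 (le_antisymm h0 (abs_nonneg _)))

open Filter Topology in
/-- Probability measures on `ℝ` with second moments at most `C` form a relatively compact set. -/
theorem exists_subseq_tendsto_of_integral_sq_le (μ : ℕ → ProbabilityMeasure ℝ) (C : ℝ)
    (hint : ∀ n, Integrable (fun x : ℝ => x ^ 2) (μ n : Measure ℝ))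
    (hC : ∀ n, ∫ x, x ^ 2 ∂(μ n : Measure ℝ) ≤ C) :
    ∃ ν : ProbabilityMeasure ℝ, ∃ φ : ℕ → ℕ, StrictMono φ ∧ Tendsto (μ ∘ φ) atTop (𝓝 ν) := by
  have hu : Tendsto (fun n : ℕ => (C / ((n : ℝ) + 1) ^ 2).toNNReal) atTop (𝓝 0) := by
    rw [← Real.toNNReal_zero]
    refine (continuous_real_toNNReal.tendsto 0).comp ?_
    refine tendsto_const_nhds.div_atTop ?_
    exact (tendsto_pow_atTop two_ne_zero).comp
      (tendsto_atTop_add_const_right _ _ tendsto_natCast_atTop_atTop)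
  have hcomp := isCompact_setOfPred_probabilityMeasure_mass_eq_compl_isCompact_le (E := ℝ) hu
    (K := fun n => Metric.closedBall (0 : ℝ) ((n : ℝ) + 1)) (fun n => isCompact_closedBall _ _)
    (Or.inl inferInstance)
  suffices hmem : ∀ n, ∀ k : ℕ, μ n (Metric.closedBall (0 : ℝ) ((k : ℝ) + 1))ᶜ ≤
      (C / ((k : ℝ) + 1) ^ 2).toNNReal by
    obtain ⟨ν, -, φ, hφ, hlim⟩ := hcomp.tendsto_subseq (x := μ) hmem
    exact ⟨ν, φ, hφ, hlim⟩
  · intro n k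
    have hk : (0 : ℝ) < ((k : ℝ) + 1) ^ 2 := by positivity
    have hm := mul_meas_ge_le_integral_of_nonneg (μ := (μ n : Measure ℝ))
      (Eventually.of_forall fun x => sq_nonneg x) (hint n) (((k : ℝ) + 1) ^ 2)
    have hsub : (μ n : Measure ℝ).real (Metric.closedBall (0 : ℝ) ((k : ℝ) + 1))ᶜ ≤
        (μ n : Measure ℝ).real {x | ((k : ℝ) + 1) ^ 2 ≤ x ^ 2} := by
      refine measureReal_mono fun x hx => ?_
      simp only [Set.mem_compl_iff, mem_closedBall_zero_iff, Real.norm_eq_abs, not_le] at hx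
      simp only [Set.mem_ofPred_eq]
      rw [← sq_abs x]
      exact pow_le_pow_left₀ (by positivity) hx.le 2
    have : (μ n : Measure ℝ).real (Metric.closedBall (0 : ℝ) ((k : ℝ) + 1))ᶜ ≤
        C / ((k : ℝ) + 1) ^ 2 := by
      rw [le_div_iff₀ hk, mul_comm]
      exact (mul_le_mul_of_nonneg_left hsub hk.le).trans (hm.trans (hC n))
    exact NNReal.le_toNNReal_of_coe_le this

open Filter Topology in
/-- Quantitative form of the method of moments: near a determinate measure, closeness of finitely
many moments forces closeness of the integrals of a bounded continuous function. -/
theorem exists_forall_moments_close_imp_integral_close (m : Measure ℝ) [IsProbabilityMeasure m]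
    (hdet : ∀ μ : Measure ℝ, IsProbabilityMeasure μ →
      (∀ j : ℕ, Integrable (fun x => x ^ j) μ) →
      (∀ j : ℕ, 1 ≤ j → (∫ x, x ^ j ∂μ) = ∫ x, x ^ j ∂m) → μ = m)
    (f : ℝ → ℝ) (hf : Continuous f) (hfb : ∃ C : ℝ, ∀ x, |f x| ≤ C) (ε : ℝ) (hε : 0 < ε) :
    ∃ K : ℕ, ∃ δ : ℝ, 0 < δ ∧ ∀ μ : Measure ℝ, IsProbabilityMeasure μ →
      (∀ j : ℕ, Integrable (fun x => x ^ j) μ) →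
      (∀ j ∈ Finset.Icc 1 K, |∫ x, x ^ j ∂μ - ∫ x, x ^ j ∂m| < δ) →
      |∫ x, f x ∂μ - ∫ x, f x ∂m| < ε := by
  by_contra! hcon
  have hex : ∀ n : ℕ, ∃ μ : ProbabilityMeasure ℝ,
      (∀ j : ℕ, Integrable (fun x : ℝ => x ^ j) (μ : Measure ℝ)) ∧
      (∀ j ∈ Finset.Icc 1 (n + 2),
        |∫ x, x ^ j ∂(μ : Measure ℝ) - ∫ x, x ^ j ∂m| < 1 / ((n : ℝ) + 1)) ∧
      ε ≤ |∫ x, f x ∂(μ : Measure ℝ) - ∫ x, f x ∂m| := by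
    intro n
    obtain ⟨μ, h1, h2, h3, h4⟩ := hcon (n + 2) (1 / ((n : ℝ) + 1)) (by positivity)
    exact ⟨⟨μ, h1⟩, h2, h3, h4⟩
  choose μ hint hmom hfar using hex
  obtain ⟨ν, φ, hφ, hlim⟩ := exists_subseq_tendsto_of_integral_sq_le μ (∫ x, x ^ 2 ∂m + 1)
    (fun n => hint n 2) (fun n => by
      have h := (abs_lt.1 (hmom n 2 (by simp))).2
      have h' : 1 / ((n : ℝ) + 1) ≤ 1 := by
        rw [div_le_one (by positivity)]
        linarith [(Nat.cast_nonneg n : (0 : ℝ) ≤ n)]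
      linarith)
  have hc : ∀ j : ℕ, 1 ≤ j → Tendsto (fun n => ∫ x, x ^ j ∂((μ ∘ φ) n : Measure ℝ)) atTop
      (𝓝 (∫ x, x ^ j ∂m)) := by
    intro j hj
    refine Tendsto.comp (g := fun n => ∫ x, x ^ j ∂(μ n : Measure ℝ)) ?_ hφ.tendsto_atTop
    rw [tendsto_iff_norm_sub_tendsto_zero]
    refine squeeze_zero' (Eventually.of_forall fun _ => norm_nonneg _) ?_
      tendsto_one_div_add_atTop_nhds_zero_nat
    filter_upwards [eventually_ge_atTop j] with n hn
    exact (hmom n j (Finset.mem_Icc.2 ⟨hj, by omega⟩)).le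
  have hνm : (ν : Measure ℝ) = m := hdet ν inferInstance
    (integrable_pow_of_tendsto hlim (fun n => hint _) hc)
    (fun j hj => integral_pow_eq_of_tendsto hlim (fun n => hint _) hc hj)
  obtain ⟨C, hC⟩ := hfb
  have hweak := (ProbabilityMeasure.tendsto_iff_forall_integral_tendsto.1 hlim)
    (BoundedContinuousFunction.ofNormedAddCommGroup f hf C hC)
  simp only [BoundedContinuousFunction.coe_ofNormedAddCommGroup, hνm] at hweak
  have h0 := (hweak.sub_const (∫ x, f x ∂m)).abs
  rw [sub_self, abs_zero] at h0
  exact absurd (ge_of_tendsto' h0 fun n => hfar (φ n)) (not_le.2 hε)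

section UnitaryRow

variable {ι : Type*} [Fintype ι]

/-- The sum of `a l` weighted by the squared moduli of the coordinates of `w * M`. -/
noncomputable def weightedRowSum (a : ι → ℝ) (w : ι → ℂ) (M : Matrix ι ι ℂ) : ℝ :=
  ∑ l, a l * ‖Matrix.vecMul w M l‖ ^ 2

theorem measurable_matrix_apply {m n α : Type*} [MeasurableSpace α] (i : m) (j : n) :
    Measurable fun M : Matrix m n α => M i j :=
  (measurable_pi_apply j).comp (measurable_pi_apply (X := fun _ : m => n → α) i)

theorem measurable_weightedRowSum (a : ι → ℝ) (w : ι → ℂ) :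
    Measurable (weightedRowSum a w) := by
  unfold weightedRowSum Matrix.vecMul dotProduct
  refine Finset.measurable_sum _ fun l _ => Measurable.const_mul (Measurable.pow_const ?_ 2) _
  exact (Finset.measurable_sum _ fun k _ => (measurable_matrix_apply k l).const_mul _).norm

theorem weightedRowSum_smul (a : ι → ℝ) (c : ℂ) (w : ι → ℂ) (M : Matrix ι ι ℂ) :
    weightedRowSum a (c • w) M = ‖c‖ ^ 2 * weightedRowSum a w M := by
  simp only [weightedRowSum, Matrix.smul_vecMul, Pi.smul_apply, smul_eq_mul, norm_mul, mul_pow,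
    Finset.mul_sum]
  exact Finset.sum_congr rfl fun l _ => by ring

/-- The sesquilinear expression `∑ l, a l * M j l * conj (M k l)`. -/
noncomputable def weightedRowInner (a : ι → ℝ) (j k : ι) (M : Matrix ι ι ℂ) : ℂ :=
  ∑ l, (a l : ℂ) * (M j l * star (M k l))

theorem measurable_weightedRowInner (a : ι → ℝ) (j k : ι) :
    Measurable (weightedRowInner a j k) := by
  unfold weightedRowInner
  refine Finset.measurable_sum _ fun l _ => Measurable.const_mul ?_ _
  exact (measurable_matrix_apply j l).mul
    (Complex.continuous_conj.measurable.comp (measurable_matrix_apply k l))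

variable [DecidableEq ι]

theorem measurable_unitary_apply (i j : ι) :
    Measurable fun u : Matrix.unitaryGroup ι ℂ => (u : Matrix ι ι ℂ) i j :=
  (measurable_matrix_apply i j).comp measurable_subtype_coe

theorem weightedRowSum_single (a : ι → ℝ) (k : ι) (M : Matrix ι ι ℂ) :
    weightedRowSum a (Pi.single k 1) M = ∑ l, a l * ‖M k l‖ ^ 2 := by
  simp [weightedRowSum]

theorem exists_unitary_row_eq (L : ι) (w : ι → ℂ) (hw : ∑ k, ‖w k‖ ^ 2 = 1) :
    ∃ V : Matrix.unitaryGroup ι ℂ, (V : Matrix ι ι ℂ) L = w := by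
  have hnorm : ‖(WithLp.toLp 2 w : EuclideanSpace ℂ ι)‖ = 1 := by
    rw [EuclideanSpace.norm_eq]
    simp [hw]
  obtain ⟨b, hb⟩ := Orthonormal.exists_orthonormalBasis_extension_of_card_eq (𝕜 := ℂ)
    (E := EuclideanSpace ℂ ι) (ι := ι) (by simp)
    (v := fun _ => WithLp.toLp 2 w) (s := {L}) (by
      constructor
      · intro i
        exact hnorm
      · intro i j hij
        exact absurd (Subsingleton.elim i j) hij)
  refine ⟨⟨Matrix.of fun i j => b i j, ?_⟩, ?_⟩
  · rw [Matrix.mem_unitaryGroup_iff]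
    ext i j
    have h := orthonormal_iff_ite.1 b.orthonormal j i
    rw [PiLp.inner_apply] at h
    rw [Matrix.mul_apply, Matrix.one_apply]
    simp only [eq_comm (a := i)]
    rw [← h]
    exact Finset.sum_congr rfl fun l _ => by simp [Matrix.star_apply]
  · ext j
    change b L j = w j
    rw [hb L rfl]

theorem measurable_unitary_mul_left (V : Matrix.unitaryGroup ι ℂ) :
    Measurable fun u : Matrix.unitaryGroup ι ℂ => V * u := by
  refine Measurable.subtype_mk ?_
  refine measurable_pi_lambda _ fun i => measurable_pi_lambda _ fun j => ?_
  change Measurable fun u : Matrix.unitaryGroup ι ℂ =>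
    ((V : Matrix ι ι ℂ) * (u : Matrix ι ι ℂ)) i j
  simp only [Matrix.mul_apply]
  exact Finset.measurable_sum _ fun k _ => (measurable_unitary_apply k j).const_mul _

theorem sum_norm_sq_unitary_col (u : Matrix.unitaryGroup ι ℂ) (l : ι) :
    ∑ k, ‖(u : Matrix ι ι ℂ) k l‖ ^ 2 = 1 := by
  have h := congrFun (congrFun (Matrix.mem_unitaryGroup_iff'.1 u.2) l) l
  rw [Matrix.mul_apply, Matrix.one_apply_eq] at h
  have h2 : ((∑ k, ‖(u : Matrix ι ι ℂ) k l‖ ^ 2 : ℝ) : ℂ) = 1 := by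
    rw [← h]
    push_cast
    exact Finset.sum_congr rfl fun k _ => by
      rw [Matrix.star_apply, ← Complex.conj_mul', Complex.star_def]
  exact_mod_cast h2

theorem sum_weightedRowSum_single (a : ι → ℝ) (u : Matrix.unitaryGroup ι ℂ) :
    ∑ k, weightedRowSum a (Pi.single k 1) (u : Matrix ι ι ℂ) = ∑ l, a l := by
  simp only [weightedRowSum_single]
  rw [Finset.sum_comm]
  refine Finset.sum_congr rfl fun l _ => ?_
  rw [← Finset.mul_sum, sum_norm_sq_unitary_col, mul_one]

theorem sum_norm_sq_weightedRowInner (a : ι → ℝ) (L : ι) (u : Matrix.unitaryGroup ι ℂ) :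
    ∑ k, ‖weightedRowInner a L k (u : Matrix ι ι ℂ)‖ ^ 2 =
      weightedRowSum (fun l => a l ^ 2) (Pi.single L 1) (u : Matrix ι ι ℂ) := by
  set M : Matrix ι ι ℂ := (u : Matrix ι ι ℂ)
  set A : Matrix ι ι ℂ := Matrix.diagonal fun l => (a l : ℂ)
  have hB : ∀ k, weightedRowInner a L k M = (M * A * star M) L k := by
    intro k
    rw [Matrix.mul_apply]
    refine Finset.sum_congr rfl fun l _ => ?_
    rw [Matrix.mul_diagonal, Matrix.star_apply]
    ring
  have hA : star A = A := by
    simp [A, Matrix.star_eq_conjTranspose, Matrix.diagonal_conjTranspose, Pi.star_def]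
  have hM : star M * M = 1 := Matrix.mem_unitaryGroup_iff'.1 u.2
  have h : (M * A * star M) * star (M * A * star M) = M * (A * A) * star M := by
    rw [star_mul, star_mul, star_star, hA]
    calc _ = M * A * (star M * M) * A * star M := by simp only [mul_assoc]
      _ = _ := by rw [hM, mul_one]; simp only [mul_assoc]
  have hc : ((∑ k, ‖weightedRowInner a L k M‖ ^ 2 : ℝ) : ℂ) =
      ((weightedRowSum (fun l => a l ^ 2) (Pi.single L 1) M : ℝ) : ℂ) := by
    have h1 := congrFun (congrFun h L) L
    rw [Matrix.mul_apply, Matrix.mul_apply, Matrix.diagonal_mul_diagonal] at h1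
    rw [weightedRowSum_single]
    push_cast
    calc _ = ∑ k, (M * A * star M) L k * star (M * A * star M) k L := by
          refine Finset.sum_congr rfl fun k _ => ?_
          rw [hB, Matrix.star_apply, ← Complex.mul_conj', Complex.star_def]
      _ = _ := by
          rw [h1]
          refine Finset.sum_congr rfl fun l _ => ?_
          rw [Matrix.mul_diagonal, Matrix.star_apply, ← Complex.mul_conj', Complex.star_def]
          ring
  exact_mod_cast hc

theorem weightedRowSum_single_add_smul_single (a : ι → ℝ) (L k : ι) (s : ℂ) (hs : ‖s‖ = 1)
    (M : Matrix ι ι ℂ) :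
    weightedRowSum a (Pi.single L 1 + s • Pi.single k 1) M =
      weightedRowSum a (Pi.single L 1) M + weightedRowSum a (Pi.single k 1) M +
        2 * (star s * weightedRowInner a L k M).re := by
  rw [weightedRowSum_single, weightedRowSum_single, weightedRowInner, Finset.mul_sum,
    Complex.re_sum, Finset.mul_sum, ← Finset.sum_add_distrib, ← Finset.sum_add_distrib]
  refine Finset.sum_congr rfl fun l _ => ?_
  have hs' : s.re ^ 2 + s.im ^ 2 = 1 := by
    rw [← one_pow 2, ← hs, ← Complex.normSq_eq_norm_sq, Complex.normSq_apply]
    ring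
  rw [Matrix.add_vecMul, Matrix.smul_vecMul, Matrix.single_one_vecMul, Matrix.single_one_vecMul]
  simp only [← Complex.normSq_eq_norm_sq, Complex.normSq_apply, Pi.add_apply, Pi.smul_apply,
    Complex.add_re, Complex.add_im, smul_eq_mul, Complex.mul_re, Complex.mul_im, Complex.star_def,
    Complex.conj_re, Complex.conj_im, Complex.ofReal_re, Complex.ofReal_im, Matrix.row]
  linear_combination (a l * ((M k l).re ^ 2 + (M k l).im ^ 2)) * hs'

theorem abs_weightedRowSum_single_le (a : ι → ℝ) (k : ι) (u : Matrix.unitaryGroup ι ℂ) :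
    |weightedRowSum a (Pi.single k 1) (u : Matrix ι ι ℂ)| ≤ ∑ l, |a l| := by
  rw [weightedRowSum_single]
  refine (Finset.abs_sum_le_sum_abs _ _).trans (Finset.sum_le_sum fun l _ => ?_)
  rw [abs_mul, abs_of_nonneg (sq_nonneg ‖(u : Matrix ι ι ℂ) k l‖)]
  exact mul_le_of_le_one_right (abs_nonneg _)
    (pow_le_one₀ (norm_nonneg _) (entry_norm_bound_of_unitary u.2 _ _))

theorem norm_weightedRowInner_le (a : ι → ℝ) (j k : ι) (u : Matrix.unitaryGroup ι ℂ) :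
    ‖weightedRowInner a j k (u : Matrix ι ι ℂ)‖ ≤ ∑ l, |a l| := by
  refine (norm_sum_le _ _).trans (Finset.sum_le_sum fun l _ => ?_)
  rw [norm_mul, norm_mul, norm_star, Complex.norm_real, Real.norm_eq_abs]
  exact mul_le_of_le_one_right (abs_nonneg _)
    (mul_le_one₀ (entry_norm_bound_of_unitary u.2 _ _) (norm_nonneg _)
      (entry_norm_bound_of_unitary u.2 _ _))

theorem integral_comp_weightedRowSum (μ : Measure (Matrix.unitaryGroup ι ℂ))
    [μ.IsMulLeftInvariant] (a : ι → ℝ) (L : ι) (w : ι → ℂ) (hw : ∑ k, ‖w k‖ ^ 2 = 1)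
    {F : ℝ → ℝ} (hF : Measurable F) :
    ∫ u, F (weightedRowSum a w (u : Matrix ι ι ℂ)) ∂μ =
      ∫ u, F (weightedRowSum a (Pi.single L 1) (u : Matrix ι ι ℂ)) ∂μ := by
  obtain ⟨V, hV⟩ := exists_unitary_row_eq L w hw
  have hmeas : Measurable fun u : Matrix.unitaryGroup ι ℂ =>
      F (weightedRowSum a (Pi.single L 1) (u : Matrix ι ι ℂ)) :=
    hF.comp ((measurable_weightedRowSum a _).comp measurable_subtype_coe)
  conv_rhs => rw [← Measure.IsMulLeftInvariant.map_mul_left_eq_self (μ := μ) V]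
  rw [integral_map (measurable_unitary_mul_left V).aemeasurable hmeas.aestronglyMeasurable]
  congr 1
  ext u
  congr 1
  simp only [weightedRowSum]
  have : Matrix.vecMul (Pi.single L 1) ((V * u : Matrix.unitaryGroup ι ℂ) : Matrix ι ι ℂ) =
      Matrix.vecMul w (u : Matrix ι ι ℂ) := by
    rw [Submonoid.coe_mul, ← Matrix.vecMul_vecMul, Matrix.single_one_vecMul]
    congr 1
  rw [this]

theorem sum_norm_sq_single (k : ι) : ∑ i, ‖(Pi.single k 1 : ι → ℂ) i‖ ^ 2 = 1 := by
  rw [Finset.sum_eq_single k] <;> simp +contextual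

theorem integral_weightedRowSum_add_smul_sq (μ : Measure (Matrix.unitaryGroup ι ℂ))
    [μ.IsMulLeftInvariant] (a : ι → ℝ) {L k : ι} (hk : k ≠ L) (s : ℂ)
    (hs : ‖s‖ = 1) :
    ∫ u, weightedRowSum a (Pi.single L 1 + s • Pi.single k 1) (u : Matrix ι ι ℂ) ^ 2 ∂μ =
      4 * ∫ u, weightedRowSum a (Pi.single L 1) (u : Matrix ι ι ℂ) ^ 2 ∂μ := by
  set w : ι → ℂ := Pi.single L 1 + s • Pi.single k 1
  have hc : ‖((√2)⁻¹ : ℂ)‖ ^ 2 = 1 / 2 := by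
    rw [norm_inv, Complex.norm_real, Real.norm_eq_abs, abs_of_nonneg (Real.sqrt_nonneg _), inv_pow,
      Real.sq_sqrt (by norm_num)]
    norm_num
  have hw2 : ∑ i, ‖w i‖ ^ 2 = 2 := by
    have : ∀ i, ‖w i‖ ^ 2 =
        ‖(Pi.single L 1 : ι → ℂ) i‖ ^ 2 + ‖(Pi.single k 1 : ι → ℂ) i‖ ^ 2 := by
      intro i
      by_cases h1 : i = L
      · subst h1
        simp [w, hk.symm]
      · by_cases h2 : i = k
        · subst h2
          simp [w, hk, hs]
        · simp [w, h1, h2]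
    rw [Finset.sum_congr rfl fun i _ => this i, Finset.sum_add_distrib, sum_norm_sq_single,
      sum_norm_sq_single]
    norm_num
  have hw : ∑ i, ‖(((√2)⁻¹ : ℂ) • w) i‖ ^ 2 = 1 := by
    simp only [Pi.smul_apply, smul_eq_mul, norm_mul, mul_pow, hc]
    rw [← Finset.mul_sum, hw2]
    norm_num
  rw [← integral_comp_weightedRowSum μ a L _ hw (F := fun x => x ^ 2) (by fun_prop),
    ← integral_const_mul]
  congr 1
  ext u
  rw [weightedRowSum_smul, hc]
  ring

variable (μ : Measure (Matrix.unitaryGroup ι ℂ)) [IsProbabilityMeasure μ]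

theorem integrable_weightedRowSum_single (a : ι → ℝ) (k : ι) :
    Integrable (fun u : Matrix.unitaryGroup ι ℂ =>
      weightedRowSum a (Pi.single k 1) (u : Matrix ι ι ℂ)) μ :=
  Integrable.of_bound
    ((measurable_weightedRowSum a _).comp measurable_subtype_coe).aestronglyMeasurable
    (∑ l, |a l|) (Filter.Eventually.of_forall fun u => abs_weightedRowSum_single_le a k u)

theorem integrable_weightedRowSum_single_mul (a : ι → ℝ) (j k : ι) :
    Integrable (fun u : Matrix.unitaryGroup ι ℂ =>
      weightedRowSum a (Pi.single j 1) (u : Matrix ι ι ℂ) *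
        weightedRowSum a (Pi.single k 1) (u : Matrix ι ι ℂ)) μ :=
  (integrable_weightedRowSum_single μ a j).mul_bdd (c := ∑ l, |a l|)
    ((measurable_weightedRowSum a _).comp measurable_subtype_coe).aestronglyMeasurable
    (Filter.Eventually.of_forall fun u => abs_weightedRowSum_single_le a k u)

theorem integrable_norm_sq_weightedRowInner (a : ι → ℝ) (j k : ι) :
    Integrable (fun u : Matrix.unitaryGroup ι ℂ =>
      ‖weightedRowInner a j k (u : Matrix ι ι ℂ)‖ ^ 2) μ := by
  refine Integrable.of_bound (((measurable_weightedRowInner a j k).comp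
    measurable_subtype_coe).norm.pow_const 2).aestronglyMeasurable ((∑ l, |a l|) ^ 2)
    (Filter.Eventually.of_forall fun u => ?_)
  rw [norm_pow, norm_norm]
  exact pow_le_pow_left₀ (norm_nonneg _) (norm_weightedRowInner_le a j k u) 2

variable [μ.IsMulLeftInvariant]

theorem integral_weightedRowSum_single (a : ι → ℝ) (L : ι) :
    (Fintype.card ι : ℝ) * ∫ u, weightedRowSum a (Pi.single L 1) (u : Matrix ι ι ℂ) ∂μ =
      ∑ l, a l := by
  have h : ∑ k, ∫ u, weightedRowSum a (Pi.single k 1) (u : Matrix ι ι ℂ) ∂μ = ∑ l, a l := by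
    rw [← integral_finsetSum _ fun k _ => integrable_weightedRowSum_single μ a k]
    simp [sum_weightedRowSum_single]
  rw [← h, Finset.sum_congr rfl fun k _ =>
    integral_comp_weightedRowSum μ a L _ (sum_norm_sq_single k) measurable_id']
  simp

theorem integral_weightedRowSum_mul_add_norm_sq (a : ι → ℝ) {L k : ι} (hk : k ≠ L) :
    ∫ u, (weightedRowSum a (Pi.single L 1) (u : Matrix ι ι ℂ) *
        weightedRowSum a (Pi.single k 1) (u : Matrix ι ι ℂ) +
        ‖weightedRowInner a L k (u : Matrix ι ι ℂ)‖ ^ 2) ∂μ =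
      ∫ u, weightedRowSum a (Pi.single L 1) (u : Matrix ι ι ℂ) ^ 2 ∂μ := by
  set q := ∫ u, weightedRowSum a (Pi.single L 1) (u : Matrix ι ι ℂ) ^ 2 ∂μ
  have hkq : ∫ u, weightedRowSum a (Pi.single k 1) (u : Matrix ι ι ℂ) ^ 2 ∂μ = q :=
    integral_comp_weightedRowSum μ a L _ (sum_norm_sq_single k) (F := fun x => x ^ 2)
      (by fun_prop)
  have hsq : ∀ i, Integrable (fun u : Matrix.unitaryGroup ι ℂ =>
      weightedRowSum a (Pi.single i 1) (u : Matrix ι ι ℂ) ^ 2) μ := by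
    intro i
    simpa only [sq] using integrable_weightedRowSum_single_mul μ a i i
  have hp : ∀ s : ℂ, ‖s‖ = 1 → Integrable (fun u : Matrix.unitaryGroup ι ℂ =>
      weightedRowSum a (Pi.single L 1 + s • Pi.single k 1) (u : Matrix ι ι ℂ) ^ 2) μ := by
    intro s hs
    refine Integrable.of_bound (((measurable_weightedRowSum a _).comp
      measurable_subtype_coe).pow_const 2).aestronglyMeasurable
      ((4 * ∑ l, |a l|) ^ 2) (Filter.Eventually.of_forall fun u => ?_)
    rw [norm_pow, Real.norm_eq_abs,
      weightedRowSum_single_add_smul_single a L k s hs]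
    refine pow_le_pow_left₀ (abs_nonneg _) ?_ 2
    have h1 := abs_le.1 (abs_weightedRowSum_single_le a L u)
    have h2 := abs_le.1 (abs_weightedRowSum_single_le a k u)
    have hz : ‖star s * weightedRowInner a L k (u : Matrix ι ι ℂ)‖ ≤ ∑ l, |a l| := by
      rw [norm_mul, norm_star, hs, one_mul]
      exact norm_weightedRowInner_le a L k u
    have h3 := abs_le.1 ((Complex.abs_re_le_norm _).trans hz)
    rw [abs_le]
    constructor <;> linarith [h1.1, h1.2, h2.1, h2.2, h3.1, h3.2]
  have hpoint : ∀ u : Matrix.unitaryGroup ι ℂ,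
      weightedRowSum a (Pi.single L 1) (u : Matrix ι ι ℂ) *
        weightedRowSum a (Pi.single k 1) (u : Matrix ι ι ℂ) +
        ‖weightedRowInner a L k (u : Matrix ι ι ℂ)‖ ^ 2 =
      1 / 8 * (weightedRowSum a (Pi.single L 1 + (1 : ℂ) • Pi.single k 1) (u : Matrix ι ι ℂ) ^ 2 +
        weightedRowSum a (Pi.single L 1 + (-1 : ℂ) • Pi.single k 1) (u : Matrix ι ι ℂ) ^ 2 +
        weightedRowSum a (Pi.single L 1 + Complex.I • Pi.single k 1) (u : Matrix ι ι ℂ) ^ 2 +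
        weightedRowSum a (Pi.single L 1 + (-Complex.I) • Pi.single k 1) (u : Matrix ι ι ℂ) ^ 2)
      - 1 / 2 * (weightedRowSum a (Pi.single L 1) (u : Matrix ι ι ℂ) ^ 2 +
          weightedRowSum a (Pi.single k 1) (u : Matrix ι ι ℂ) ^ 2) := by
    intro u
    rw [weightedRowSum_single_add_smul_single a L k 1 (by simp),
      weightedRowSum_single_add_smul_single a L k (-1) (by simp),
      weightedRowSum_single_add_smul_single a L k Complex.I (by simp),
      weightedRowSum_single_add_smul_single a L k (-Complex.I) (by simp),
      ← Complex.normSq_eq_norm_sq, Complex.normSq_apply]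
    simp only [Complex.star_def, map_one, map_neg, Complex.conj_I, neg_neg, neg_mul, one_mul,
      Complex.neg_re, Complex.I_mul_re]
    ring
  have i1 := hp 1 (by simp)
  have i2 := hp (-1) (by simp)
  have i3 := hp Complex.I (by simp)
  have i4 := hp (-Complex.I) (by simp)
  have i12 := integral_add i1 i2
  have i123 := integral_add (i1.add i2) i3
  have i1234 := integral_add ((i1.add i2).add i3) i4
  have ig := integral_add (hsq L) (hsq k)
  have hall := integral_sub ((((i1.add i2).add i3).add i4).const_mul (1 / 8))
    (((hsq L).add (hsq k)).const_mul (1 / 2))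
  simp only [Pi.add_apply] at i12 i123 i1234 ig hall
  simp only [hpoint]
  rw [hall, integral_const_mul, integral_const_mul, i1234, i123, i12, ig, hkq,
    integral_weightedRowSum_add_smul_sq μ a hk _ (by simp),
    integral_weightedRowSum_add_smul_sq μ a hk _ (by simp),
    integral_weightedRowSum_add_smul_sq μ a hk _ (by simp),
    integral_weightedRowSum_add_smul_sq μ a hk _ (by simp)]
  ring

theorem integral_weightedRowSum_single_sq (a : ι → ℝ) (L : ι) :
    (Fintype.card ι : ℝ) * ((Fintype.card ι + 1 : ℝ) *
      ∫ u, weightedRowSum a (Pi.single L 1) (u : Matrix ι ι ℂ) ^ 2 ∂μ) =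
      (∑ l, a l) ^ 2 + ∑ l, a l ^ 2 := by
  set q := ∫ u, weightedRowSum a (Pi.single L 1) (u : Matrix ι ι ℂ) ^ 2 ∂μ with hq
  have hdiag : ∫ u, (weightedRowSum a (Pi.single L 1) (u : Matrix ι ι ℂ) *
        weightedRowSum a (Pi.single L 1) (u : Matrix ι ι ℂ) +
        ‖weightedRowInner a L L (u : Matrix ι ι ℂ)‖ ^ 2) ∂μ = q + q := by
    rw [hq, ← two_mul, ← integral_const_mul]
    congr 1
    ext u
    have : weightedRowInner a L L (u : Matrix ι ι ℂ) =
        ((weightedRowSum a (Pi.single L 1) (u : Matrix ι ι ℂ) : ℝ) : ℂ) := by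
      rw [weightedRowSum_single, weightedRowInner]
      push_cast
      exact Finset.sum_congr rfl fun l _ => by rw [← Complex.mul_conj', Complex.star_def]
    rw [this, Complex.norm_real, Real.norm_eq_abs, sq_abs]
    ring
  have hint : ∀ k, Integrable (fun u : Matrix.unitaryGroup ι ℂ =>
      weightedRowSum a (Pi.single L 1) (u : Matrix ι ι ℂ) *
        weightedRowSum a (Pi.single k 1) (u : Matrix ι ι ℂ) +
        ‖weightedRowInner a L k (u : Matrix ι ι ℂ)‖ ^ 2) μ := fun k =>
    (integrable_weightedRowSum_single_mul μ a L k).add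
      (integrable_norm_sq_weightedRowInner μ a L k)
  have hsum1 : ∑ k, ∫ u, (weightedRowSum a (Pi.single L 1) (u : Matrix ι ι ℂ) *
        weightedRowSum a (Pi.single k 1) (u : Matrix ι ι ℂ) +
        ‖weightedRowInner a L k (u : Matrix ι ι ℂ)‖ ^ 2) ∂μ = (Fintype.card ι + 1 : ℝ) * q := by
    rw [← Finset.add_sum_erase _ _ (Finset.mem_univ L), hdiag, Finset.sum_congr rfl fun k hk =>
      integral_weightedRowSum_mul_add_norm_sq μ a (Finset.ne_of_mem_erase hk)]
    rw [Finset.sum_const, Finset.card_erase_of_mem (Finset.mem_univ L), Finset.card_univ,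
      nsmul_eq_mul, Nat.cast_sub (Fintype.card_pos_iff.2 ⟨L⟩)]
    push_cast
    ring
  have hpoint : ∀ u : Matrix.unitaryGroup ι ℂ,
      ∑ k, (weightedRowSum a (Pi.single L 1) (u : Matrix ι ι ℂ) *
        weightedRowSum a (Pi.single k 1) (u : Matrix ι ι ℂ) +
        ‖weightedRowInner a L k (u : Matrix ι ι ℂ)‖ ^ 2) =
      weightedRowSum a (Pi.single L 1) (u : Matrix ι ι ℂ) * (∑ l, a l) +
        weightedRowSum (fun l => a l ^ 2) (Pi.single L 1) (u : Matrix ι ι ℂ) := by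
    intro u
    rw [Finset.sum_add_distrib, ← Finset.mul_sum, sum_weightedRowSum_single,
      sum_norm_sq_weightedRowInner]
  rw [← hsum1, ← integral_finsetSum _ fun k _ => hint k]
  simp only [hpoint]
  rw [integral_add ((integrable_weightedRowSum_single μ a L).mul_const _)
    (integrable_weightedRowSum_single μ _ L), integral_mul_const, mul_add, ← mul_assoc,
    integral_weightedRowSum_single, integral_weightedRowSum_single]
  ring

/-- Variance bound for a diagonal entry of a Haar unitary conjugation of a diagonal matrix. -/
theorem lintegral_weightedRowSum_sub_mean_sq_le (a : ι → ℝ) (L : ι) :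
    ∫⁻ u, ENNReal.ofReal ((weightedRowSum a (Pi.single L 1) (u : Matrix ι ι ℂ) -
      (1 / (Fintype.card ι : ℝ)) * ∑ l, a l) ^ 2) ∂μ ≤
      ENNReal.ofReal ((1 / (Fintype.card ι : ℝ)) * ((1 / (Fintype.card ι : ℝ)) *
        ∑ l, a l ^ 2)) := by
  set c := (1 / (Fintype.card ι : ℝ)) * ∑ l, a l with hc
  set N : ℝ := (Fintype.card ι : ℝ) with hN
  have hN0 : 0 < N := Nat.cast_pos.2 (Fintype.card_pos_iff.2 ⟨L⟩)
  have h1 := integrable_weightedRowSum_single μ a L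
  have h2 : Integrable (fun u : Matrix.unitaryGroup ι ℂ =>
      weightedRowSum a (Pi.single L 1) (u : Matrix ι ι ℂ) ^ 2) μ := by
    simpa only [sq] using integrable_weightedRowSum_single_mul μ a L L
  have hexp : ∀ u : Matrix.unitaryGroup ι ℂ,
      (weightedRowSum a (Pi.single L 1) (u : Matrix ι ι ℂ) - c) ^ 2 =
      weightedRowSum a (Pi.single L 1) (u : Matrix ι ι ℂ) ^ 2 -
        weightedRowSum a (Pi.single L 1) (u : Matrix ι ι ℂ) * (2 * c) + c ^ 2 := by
    intro u
    ring
  have hint : Integrable (fun u : Matrix.unitaryGroup ι ℂ =>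
      (weightedRowSum a (Pi.single L 1) (u : Matrix ι ι ℂ) - c) ^ 2) μ := by
    simp only [hexp]
    exact (h2.sub (h1.mul_const _)).add (integrable_const _)
  rw [← ofReal_integral_eq_lintegral_ofReal hint
    (Filter.Eventually.of_forall fun u => sq_nonneg _)]
  refine ENNReal.ofReal_le_ofReal ?_
  have hval : ∫ u, (weightedRowSum a (Pi.single L 1) (u : Matrix ι ι ℂ) - c) ^ 2 ∂μ =
      ((∑ l, a l) ^ 2 + ∑ l, a l ^ 2) / (N * (N + 1)) - c ^ 2 := by
    have hadd := integral_add (h2.sub (h1.mul_const (2 * c))) (integrable_const (μ := μ) (c ^ 2))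
    simp only [Pi.sub_apply] at hadd
    simp only [hexp]
    rw [hadd, integral_sub h2 (h1.mul_const _), integral_mul_const]
    have e1 : ∫ u, weightedRowSum a (Pi.single L 1) (u : Matrix ι ι ℂ) ∂μ = c := by
      rw [hc, ← integral_weightedRowSum_single μ a L, ← hN]
      field_simp
    have e2 := integral_weightedRowSum_single_sq μ a L
    rw [← e2, e1]
    simp only [integral_const, probReal_univ, smul_eq_mul, one_mul]
    field_simp
    ring
  have hS2 : 0 ≤ ∑ l, a l ^ 2 := Finset.sum_nonneg fun l _ => sq_nonneg _
  rw [hval, hc]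
  have : 1 / N * (1 / N * ∑ l, a l ^ 2) - (((∑ l, a l) ^ 2 + ∑ l, a l ^ 2) / (N * (N + 1)) -
      (1 / N * ∑ l, a l) ^ 2) =
      ((∑ l, a l) ^ 2 + ∑ l, a l ^ 2) / (N ^ 2 * (N + 1)) := by
    field_simp
    ring
  have hpos : 0 ≤ ((∑ l, a l) ^ 2 + ∑ l, a l ^ 2) / (N ^ 2 * (N + 1)) := by positivity
  linarith

/-- Second moment estimate for the diagonal entries of `(U D U^*)^k`, for `U` Haar distributed on
the unitary group and independent of `D`. -/
theorem lintegral_weightedRowSum_sub_mean_sq_le_of_indepFun {Ω : Type*} [MeasurableSpace Ω]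
    {Pr : Measure Ω} [IsProbabilityMeasure Pr] {U : Ω → Matrix ι ι ℂ} {D : Ω → ι → ℝ}
    (hU : Measurable U) (hD : Measurable D) (hUuni : ∀ ω, U ω ∈ Matrix.unitaryGroup ι ℂ)
    (hinv : (Measure.map (fun ω => (⟨U ω, hUuni ω⟩ : Matrix.unitaryGroup ι ℂ))
      Pr).IsMulLeftInvariant)
    (hindep : IndepFun U D Pr) (L : ι) (k : ℕ) :
    ∫⁻ ω, ENNReal.ofReal ((weightedRowSum (fun l => D ω l ^ k) (Pi.single L 1) (U ω) -
      (1 / (Fintype.card ι : ℝ)) * ∑ l, D ω l ^ k) ^ 2) ∂Pr ≤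
      ∫⁻ ω, ENNReal.ofReal ((1 / (Fintype.card ι : ℝ)) * ((1 / (Fintype.card ι : ℝ)) *
        ∑ l, D ω l ^ (2 * k))) ∂Pr := by
  have hU' : Measurable fun ω => (⟨U ω, hUuni ω⟩ : Matrix.unitaryGroup ι ℂ) :=
    hU.subtype_mk
  set μ := Measure.map (fun ω => (⟨U ω, hUuni ω⟩ : Matrix.unitaryGroup ι ℂ)) Pr with hμ
  have : IsProbabilityMeasure μ := Measure.isProbabilityMeasure_map hU'.aemeasurable
  have : IsProbabilityMeasure (Pr.map U) := Measure.isProbabilityMeasure_map hU.aemeasurable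
  have : IsProbabilityMeasure (Pr.map D) := Measure.isProbabilityMeasure_map hD.aemeasurable
  have hmap : Pr.map U = μ.map Subtype.val := by
    rw [hμ, Measure.map_map measurable_subtype_coe hU']
    rfl
  let F : Matrix ι ι ℂ × (ι → ℝ) → ENNReal := fun p =>
    ENNReal.ofReal ((weightedRowSum (fun l => p.2 l ^ k) (Pi.single L 1) p.1 -
      (1 / (Fintype.card ι : ℝ)) * ∑ l, p.2 l ^ k) ^ 2)
  have hcoord : ∀ (l : ι) (j : ℕ), Measurable fun d : ι → ℝ => d l ^ j := fun l j =>
    (measurable_pi_apply l).pow_const j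
  have hF : Measurable F := by
    refine ENNReal.measurable_ofReal.comp (Measurable.pow_const (Measurable.sub ?_ ?_) 2)
    · simp only [weightedRowSum_single]
      refine Finset.measurable_sum _ fun l _ => ((hcoord l k).comp measurable_snd).mul ?_
      exact ((measurable_matrix_apply L l).comp measurable_fst).norm.pow_const 2
    · exact (Finset.measurable_sum _ fun l _ => (hcoord l k).comp measurable_snd).const_mul _
  have hG : Measurable fun d : ι → ℝ => ENNReal.ofReal ((1 / (Fintype.card ι : ℝ)) *
      ((1 / (Fintype.card ι : ℝ)) * ∑ l, d l ^ (2 * k))) :=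
    ENNReal.measurable_ofReal.comp
      (((Finset.measurable_sum _ fun l _ => hcoord l (2 * k)).const_mul _).const_mul _)
  calc _ = ∫⁻ p, F p ∂(Pr.map fun ω => (U ω, D ω)) := (lintegral_map hF (hU.prodMk hD)).symm
    _ = ∫⁻ d, ∫⁻ M, F (M, d) ∂(Pr.map U) ∂(Pr.map D) := by
        rw [(indepFun_iff_map_prod_eq_prod_map_map hU.aemeasurable hD.aemeasurable).1 hindep,
          lintegral_prod_symm _ hF.aemeasurable]
    _ ≤ ∫⁻ d, ENNReal.ofReal ((1 / (Fintype.card ι : ℝ)) * ((1 / (Fintype.card ι : ℝ)) *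
        ∑ l, d l ^ (2 * k))) ∂(Pr.map D) := by
        refine lintegral_mono fun d => ?_
        have hFd : Measurable fun M : Matrix ι ι ℂ => F (M, d) :=
          hF.comp (measurable_id.prodMk measurable_const)
        rw [hmap, lintegral_map hFd measurable_subtype_coe]
        refine (lintegral_weightedRowSum_sub_mean_sq_le μ (fun l => d l ^ k) L).trans_eq ?_
        simp only [← pow_mul, mul_comm k 2]
    _ = _ := lintegral_map hG hD

end UnitaryRow

theorem conj_diagonal_pow {ι R : Type*} [Fintype ι] [DecidableEq ι] [CommRing R]
    {V W : Matrix ι ι R} (hVW : V * W = 1) (x : ι → R) (k : ℕ) :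
    (V * Matrix.diagonal x * W) ^ k = V * Matrix.diagonal (fun i => x i ^ k) * W := by
  have hWV : W * V = 1 := mul_eq_one_comm.1 hVW
  induction k with
  | zero => simp [hVW]
  | succ k ih =>
    rw [pow_succ, ih]
    calc _ = V * Matrix.diagonal (fun i => x i ^ k) * (W * V) * Matrix.diagonal x * W := by
          simp only [mul_assoc]
      _ = _ := by
          rw [hWV, mul_one, mul_assoc V, Matrix.diagonal_mul_diagonal]
          simp only [pow_succ]

theorem trace_conj_diagonal_pow {ι R : Type*} [Fintype ι] [DecidableEq ι] [CommRing R]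
    {V W : Matrix ι ι R} (hVW : V * W = 1) (x : ι → R) (k : ℕ) :
    ((V * Matrix.diagonal x * W) ^ k).trace = ∑ i, x i ^ k := by
  rw [conj_diagonal_pow hVW, Matrix.trace_mul_comm, ← mul_assoc, mul_eq_one_comm.1 hVW, one_mul,
    Matrix.trace_diagonal]

theorem conj_diagonal_pow_apply_self {ι : Type*} [Fintype ι] [DecidableEq ι] {V : Matrix ι ι ℂ}
    (hV : V ∈ Matrix.unitaryGroup ι ℂ) (x : ι → ℝ) (k : ℕ) (L : ι) :
    ((V * Matrix.diagonal (fun i => (x i : ℂ)) * star V) ^ k) L L =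
      ((weightedRowSum (fun i => x i ^ k) (Pi.single L 1) V : ℝ) : ℂ) := by
  rw [conj_diagonal_pow (Matrix.mem_unitaryGroup_iff.1 hV), Matrix.mul_apply,
    weightedRowSum_single]
  push_cast
  refine Finset.sum_congr rfl fun l _ => ?_
  rw [Matrix.mul_diagonal, Matrix.star_apply, ← Complex.mul_conj', Complex.star_def]
  ring

/-- The Markov–Krein recursion determines the moments. -/
theorem moments_eq_of_recursion {κ p q : ℕ → ℝ} (hp0 : p 0 = 1)
    (hp : ∀ j : ℕ, ((j + 1 : ℕ) : ℝ) * p (j + 1) =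
      ∑ r ∈ Finset.range (j + 1), κ (r + 1) * p (j - r))
    (hq : ∀ j : ℕ, 1 ≤ j → κ j = j * q j - ∑ r ∈ Finset.Ico 1 j, κ r * q (j - r))
    {j : ℕ} (hj : 1 ≤ j) : q j = p j := by
  induction j using Nat.strong_induction_on with
  | _ j ih =>
    obtain ⟨j, rfl⟩ : ∃ i, j = i + 1 := ⟨j - 1, by omega⟩
    have h1 := hp j
    have h2 := hq (j + 1) hj
    rw [Finset.sum_Ico_eq_sum_range, Nat.add_sub_cancel] at h2
    rw [Finset.sum_range_succ, Nat.sub_self, hp0, mul_one] at h1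
    have h3 : ∑ r ∈ Finset.range j, κ (1 + r) * q (j + 1 - (1 + r)) =
        ∑ r ∈ Finset.range j, κ (r + 1) * p (j - r) := by
      refine Finset.sum_congr rfl fun r hr => ?_
      have hr' := Finset.mem_range.1 hr
      rw [add_comm 1 r, Nat.add_sub_add_right, ih (j - r) (by omega) (by omega)]
    rw [h3] at h2
    have h4 : ((j + 1 : ℕ) : ℝ) * q (j + 1) = ((j + 1 : ℕ) : ℝ) * p (j + 1) := by linarith
    exact mul_left_cancel₀ (Nat.cast_ne_zero.2 (Nat.succ_ne_zero j)) h4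

/-- The transition measure of the Rayleigh measure of a Hermitian matrix has the moments of the
spectral measure at the last basis vector. -/
theorem transition_moments_eq_weightedRowSum {n : ℕ}
    {X U : Matrix (Fin (n + 1)) (Fin (n + 1)) ℂ} {d lam : Fin (n + 1) → ℝ} {lamt : Fin n → ℝ}
    (hU : U ∈ Matrix.unitaryGroup (Fin (n + 1)) ℂ)
    (hX : X = U * Matrix.diagonal (fun i => (d i : ℂ)) * star U)
    (hlam : ∃ V ∈ Matrix.unitaryGroup (Fin (n + 1)) ℂ,
      X = V * Matrix.diagonal (fun i => (lam i : ℂ)) * star V)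
    (hlamt : ∃ V ∈ Matrix.unitaryGroup (Fin n) ℂ,
      X.submatrix Fin.castSucc Fin.castSucc
        = V * Matrix.diagonal (fun j => (lamt j : ℂ)) * star V)
    {κ q : ℕ → ℝ} (hκ : ∀ k, κ k = (∑ i, lam i ^ k) - ∑ j, lamt j ^ k)
    (hq : ∀ j : ℕ, 1 ≤ j → κ j = j * q j - ∑ r ∈ Finset.Ico 1 j, κ r * q (j - r))
    {j : ℕ} (hj : 1 ≤ j) :
    q j = weightedRowSum (fun i => d i ^ j) (Pi.single (Fin.last n) 1) U := by
  obtain ⟨V, hV, hXV⟩ := hlam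
  obtain ⟨V', hV', hXV'⟩ := hlamt
  have hpow : ∀ k, (X ^ k) (Fin.last n) (Fin.last n) =
      ((weightedRowSum (fun i => d i ^ k) (Pi.single (Fin.last n) 1) U : ℝ) : ℂ) := fun k => by
    rw [hX, conj_diagonal_pow_apply_self hU]
  refine moments_eq_of_recursion
    (p := fun k => weightedRowSum (fun i => d i ^ k) (Pi.single (Fin.last n) 1) U) ?_
    (fun i => ?_) hq hj
  · have h := hpow 0
    rw [pow_zero, Matrix.one_apply_eq] at h
    exact_mod_cast h.symm
  · have h := markovKrein_recursion X V (star V) _ (Matrix.mem_unitaryGroup_iff.1 hV) hXV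
      V' (star V') _ (Matrix.mem_unitaryGroup_iff.1 hV') hXV' i
    simp only [hpow] at h
    simp only [hκ]
    exact_mod_cast h

theorem sum_eigenvalues_pow_eq {ι : Type*} [Fintype ι] [DecidableEq ι] {X U : Matrix ι ι ℂ}
    {d lam : ι → ℝ} (hU : U ∈ Matrix.unitaryGroup ι ℂ)
    (hX : X = U * Matrix.diagonal (fun i => (d i : ℂ)) * star U)
    (hlam : ∃ V ∈ Matrix.unitaryGroup ι ℂ,
      X = V * Matrix.diagonal (fun i => (lam i : ℂ)) * star V) (k : ℕ) :
    ∑ i, lam i ^ k = ∑ i, d i ^ k := by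
  obtain ⟨V, hV, hXV⟩ := hlam
  have h1 := trace_conj_diagonal_pow (Matrix.mem_unitaryGroup_iff.1 hU) (fun i => (d i : ℂ)) k
  have h2 := trace_conj_diagonal_pow (Matrix.mem_unitaryGroup_iff.1 hV) (fun i => (lam i : ℂ)) k
  rw [← hX] at h1
  rw [← hXV, h1] at h2
  exact_mod_cast h2.symm

open Filter Topology in
theorem tendsto_measure_abs_ge_of_lintegral_sq_le {Ω : Type*} [MeasurableSpace Ω] {Pr : Measure Ω}
    {A : ℕ → Ω → ℝ} (hA : ∀ n, AEMeasurable (A n) Pr) (C : ℝ)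
    (hC : ∀ n : ℕ, ∫⁻ ω, ENNReal.ofReal (A n ω ^ 2) ∂Pr ≤ ENNReal.ofReal (C / ((n : ℝ) + 1)))
    {δ : ℝ} (hδ : 0 < δ) :
    Tendsto (fun n => Pr {ω | δ ≤ |A n ω|}) atTop (𝓝 0) := by
  have hlim : Tendsto (fun n : ℕ => ENNReal.ofReal (C / ((n : ℝ) + 1) / δ ^ 2)) atTop (𝓝 0) := by
    rw [← ENNReal.ofReal_zero]
    refine (ENNReal.continuous_ofReal.tendsto 0).comp ?_
    rw [← zero_div (δ ^ 2)]
    exact (tendsto_const_nhds.div_atTop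
      (tendsto_atTop_add_const_right _ _ tendsto_natCast_atTop_atTop)).div_const _
  refine tendsto_of_tendsto_of_tendsto_of_le_of_le tendsto_const_nhds hlim (fun _ => zero_le)
    fun n => ?_
  have hmarkov := mul_meas_ge_le_lintegral₀ (μ := Pr)
    (ENNReal.measurable_ofReal.comp_aemeasurable ((hA n).pow_const 2)) (ENNReal.ofReal (δ ^ 2))
  have hδ2 : 0 < δ ^ 2 := by positivity
  rw [ENNReal.ofReal_div_of_pos hδ2, ENNReal.le_div_iff_mul_le
    (Or.inl (ENNReal.ofReal_pos.2 hδ2).ne') (Or.inl ENNReal.ofReal_ne_top), mul_comm]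
  refine le_trans (mul_le_mul_right (measure_mono fun ω hω => ?_) _) (hmarkov.trans (hC n))
  change ENNReal.ofReal (δ ^ 2) ≤ ENNReal.ofReal (A n ω ^ 2)
  refine ENNReal.ofReal_le_ofReal ?_
  rw [← sq_abs (A n ω)]
  exact pow_le_pow_left₀ hδ.le hω 2

/-- In the setting of the rotationally invariant Hermitian random
matrices `X_N = U_N D_N U_N^*`, let `g_N` be the (random) transition measure of the
Rayleigh measure `κ_N`, i.e. the random probability measure whose moments satisfy the
Markov–Krein recursion with the moments of `κ_N`.  If `sup_N E[M_k(m_N)] < ∞` for all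
even `k`, the moments of `m_N` converge in probability to those of a probability
measure `m` with finite moments of all orders, and the moment sequence of `m` is
determinate, then `g_N` converges weakly to `m` in probability: for every bounded
continuous `f : ℝ → ℝ` and `ε > 0`, `P(|∫ f dg_N − ∫ f dm| ≥ ε) → 0`. -/
theorem statement9
    {Ω : Type} [MeasurableSpace Ω] (Pr : Measure Ω) [IsProbabilityMeasure Pr]
    (U : (n : ℕ) → Ω → Matrix (Fin (n + 1)) (Fin (n + 1)) ℂ)
    (D : (n : ℕ) → Ω → (Fin (n + 1) → ℝ))
    (hUmeas : ∀ n, Measurable (U n))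
    (hDmeas : ∀ n, Measurable (D n))
    (hUuni : ∀ n ω, U n ω ∈ Matrix.unitaryGroup (Fin (n + 1)) ℂ)
    -- `U_N` is Haar distributed on the unitary group:
    (hHaar : ∀ n, (Measure.map
      (fun ω => (⟨U n ω, hUuni n ω⟩ : Matrix.unitaryGroup (Fin (n + 1)) ℂ)) Pr).IsHaarMeasure)
    -- `D_N` is independent of `U_N`:
    (hindep : ∀ n, IndepFun (U n) (D n) Pr)
    (X : (n : ℕ) → Ω → Matrix (Fin (n + 1)) (Fin (n + 1)) ℂ)
    (hX : ∀ n ω, X n ω = U n ω * Matrix.diagonal (fun i => (D n ω i : ℂ)) * star (U n ω))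
    -- the ordered eigenvalues `λ_1 ≤ ⋯ ≤ λ_N` of `X_N`:
    (lam : (n : ℕ) → Ω → (Fin (n + 1) → ℝ))
    (hlam_mono : ∀ n ω, Monotone (lam n ω))
    (hlam_eig : ∀ n ω, ∃ V ∈ Matrix.unitaryGroup (Fin (n + 1)) ℂ,
      X n ω = V * Matrix.diagonal (fun i => (lam n ω i : ℂ)) * star V)
    -- the ordered eigenvalues `λ̃_1 ≤ ⋯ ≤ λ̃_{N−1}` of the principal submatrix:
    (lamt : (n : ℕ) → Ω → (Fin n → ℝ))
    (hlamt_mono : ∀ n ω, Monotone (lamt n ω))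
    (hlamt_eig : ∀ n ω, ∃ V ∈ Matrix.unitaryGroup (Fin n) ℂ,
      (X n ω).submatrix Fin.castSucc Fin.castSucc
        = V * Matrix.diagonal (fun j => (lamt n ω j : ℂ)) * star V)
    -- the moments of the empirical eigenvalue distribution `m_N`:
    (Mm : ℕ → ℕ → Ω → ℝ)
    (hMm : ∀ n k ω, Mm n k ω = (1 / (n + 1 : ℝ)) * ∑ i, lam n ω i ^ k)
    (hint : ∀ n k, Integrable (Mm n k) Pr)
    -- `sup_{N ≥ 1} E[M_k(m_N)] < ∞` for every even `k`:
    (hsup : ∀ k : ℕ, Even k → ∃ C : ℝ, ∀ n, (∫ ω, Mm n k ω ∂Pr) ≤ C)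
    -- the moments of the Rayleigh measure `κ_N`:
    (Mκ : ℕ → ℕ → Ω → ℝ)
    (hMκ : ∀ n k ω, Mκ n k ω = (∑ i, lam n ω i ^ k) - ∑ j, lamt n ω j ^ k)
    -- the limiting probability measure `m`, with finite moments of all orders:
    (m : Measure ℝ) [IsProbabilityMeasure m]
    (hm : ∀ j : ℕ, Integrable (fun x => x ^ j) m)
    -- the moment sequence of `m` is determinate:
    (hdet : ∀ μ : Measure ℝ, IsProbabilityMeasure μ →
      (∀ j : ℕ, Integrable (fun x => x ^ j) μ) →
      (∀ j : ℕ, 1 ≤ j → (∫ x, x ^ j ∂μ) = ∫ x, x ^ j ∂m) → μ = m)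
    -- the random transition measure `g_N` of `κ_N`: a random probability measure with
    -- finite moments of all orders, whose moments satisfy the Markov–Krein recursion
    -- with the moments of `κ_N`:
    (g : ℕ → Ω → Measure ℝ)
    (hgprob : ∀ n ω, IsProbabilityMeasure (g n ω))
    (hgmeas : ∀ n, Measurable (g n))
    (hgmom : ∀ n ω, ∀ j : ℕ, Integrable (fun x => x ^ j) (g n ω))
    (hg : ∀ n ω, ∀ j : ℕ, 1 ≤ j → Mκ n j ω
      = j * (∫ x, x ^ j ∂(g n ω))
        - ∑ r ∈ Finset.Ico 1 j, Mκ n r ω * ∫ x, x ^ (j - r) ∂(g n ω))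
    -- the moments of `m_N` converge to those of `m` in probability:
    (hconv : ∀ j : ℕ, 1 ≤ j → ∀ ε : ℝ, 0 < ε →
      Filter.Tendsto (fun n => Pr {ω | ε ≤ |Mm n j ω - ∫ x, x ^ j ∂m|})
        Filter.atTop (nhds 0))
    (f : ℝ → ℝ) (hf : Continuous f) (hfb : ∃ C : ℝ, ∀ x, |f x| ≤ C)
    (ε : ℝ) (hε : 0 < ε) :
    Filter.Tendsto (fun n => Pr {ω | ε ≤ |(∫ x, f x ∂(g n ω)) - ∫ x, f x ∂m|})
      Filter.atTop (nhds 0) := by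
  set p : ℕ → ℕ → Ω → ℝ := fun n k ω =>
    weightedRowSum (fun l => D n ω l ^ k) (Pi.single (Fin.last n) 1) (U n ω) with hp
  have hgp : ∀ n ω, ∀ j : ℕ, 1 ≤ j → ∫ x, x ^ j ∂(g n ω) = p n j ω := fun n ω j hj =>
    transition_moments_eq_weightedRowSum (κ := fun k => Mκ n k ω)
      (q := fun j => ∫ x, x ^ j ∂(g n ω)) (hUuni n ω) (hX n ω) (hlam_eig n ω) (hlamt_eig n ω)
      (fun k => hMκ n k ω) (hg n ω) hj
  have hcard : ∀ n : ℕ, (Fintype.card (Fin (n + 1)) : ℝ) = (n : ℝ) + 1 := fun n => by simp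
  have hMD : ∀ n k ω, Mm n k ω =
      (1 / (Fintype.card (Fin (n + 1)) : ℝ)) * ∑ l, D n ω l ^ k := fun n k ω => by
    rw [hMm, hcard, sum_eigenvalues_pow_eq (hUuni n ω) (hX n ω) (hlam_eig n ω)]
  have hpmeas : ∀ n k, Measurable (p n k) := by
    intro n k
    simp only [hp, weightedRowSum_single]
    refine Finset.measurable_sum _ fun l _ => Measurable.mul ?_ ?_
    · exact ((measurable_pi_apply l).comp (hDmeas n)).pow_const k
    · exact ((measurable_matrix_apply (Fin.last n) l).comp (hUmeas n)).norm.pow_const 2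
  have hdiff : ∀ k : ℕ, ∀ δ : ℝ, 0 < δ →
      Filter.Tendsto (fun n => Pr {ω | δ ≤ |p n k ω - Mm n k ω|}) Filter.atTop (nhds 0) := by
    intro k δ hδ
    obtain ⟨C, hC⟩ := hsup (2 * k) (even_two_mul k)
    refine tendsto_measure_abs_ge_of_lintegral_sq_le
      (fun n => (hpmeas n k).aemeasurable.sub (hint n k).aemeasurable) C (fun n => ?_) hδ
    have h := lintegral_weightedRowSum_sub_mean_sq_le_of_indepFun (hUmeas n) (hDmeas n) (hUuni n)
      (hHaar n).toIsMulLeftInvariant (hindep n) (Fin.last n) k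
    simp only [← hMD] at h
    refine h.trans ?_
    have hn : (0 : ℝ) < (n : ℝ) + 1 := by positivity
    rw [← ofReal_integral_eq_lintegral_ofReal ((hint n (2 * k)).const_mul _)
      (Filter.Eventually.of_forall fun ω => ?_), integral_const_mul, hcard]
    · refine ENNReal.ofReal_le_ofReal ?_
      rw [one_div, inv_mul_eq_div]
      exact div_le_div_of_nonneg_right (hC n) hn.le
    · change (0 : ℝ) ≤ 1 / (Fintype.card (Fin (n + 1)) : ℝ) * Mm n (2 * k) ω
      rw [hMD]
      have := fun l => (even_two_mul k).pow_nonneg (D n ω l)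
      exact mul_nonneg (by positivity)
        (mul_nonneg (by positivity) (Finset.sum_nonneg fun l _ => this l))
  obtain ⟨K, δ, hδ, hclose⟩ :=
    exists_forall_moments_close_imp_integral_close m hdet f hf hfb ε hε
  have hδ2 : 0 < δ / 2 := half_pos hδ
  have hlim : Filter.Tendsto (fun n => ∑ j ∈ Finset.Icc 1 K,
      (Pr {ω | δ / 2 ≤ |p n j ω - Mm n j ω|} + Pr {ω | δ / 2 ≤ |Mm n j ω - ∫ x, x ^ j ∂m|}))
      Filter.atTop (nhds 0) := by
    simpa using tendsto_finsetSum (Finset.Icc 1 K) fun j hj =>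
      (hdiff j _ hδ2).add (hconv j (Finset.mem_Icc.1 hj).1 _ hδ2)
  refine tendsto_of_tendsto_of_tendsto_of_le_of_le tendsto_const_nhds hlim (fun _ => zero_le)
    fun n => ?_
  refine le_trans (measure_mono (t := ⋃ j ∈ Finset.Icc 1 K,
    ({ω | δ / 2 ≤ |p n j ω - Mm n j ω|} ∪ {ω | δ / 2 ≤ |Mm n j ω - ∫ x, x ^ j ∂m|}))
    fun ω hω => ?_) ((measure_biUnion_finset_le _ _).trans
      (Finset.sum_le_sum fun j _ => measure_union_le _ _))
  by_contra hnot
  simp only [Set.mem_iUnion, Set.mem_union, Set.mem_ofPred_eq, not_exists, not_or, not_le] at hnot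
  refine absurd (hclose (g n ω) (hgprob n ω) (hgmom n ω) fun j hj => ?_) (not_lt.2 hω)
  rw [hgp n ω j (Finset.mem_Icc.1 hj).1]
  obtain ⟨h1, h2⟩ := hnot j hj
  linarith [abs_sub_le (p n j ω) (Mm n j ω) (∫ x, x ^ j ∂m)]
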